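/- Define F(a) = F₁(2a; a+1/2, 4a−1; 2a+1/2; 1/81, 1/6) for complex a avoiding poles of the series. Then F satisfies the closed-form contiguity relation F(a+1)/F(a) = (3⁸ / (2² · 5⁵)) · (2a+1/2)(2a+3/2) / (a+1/2)², equivalently F(a+1) · (a+1/2)² · 2² · 5⁵ = F(a) · 3⁸ · (2a+1/2)(2a+3/2). -/

import Mathlib

open scoped Nat

/-- Pochhammer symbol (rising factorial) on the complex numbers. -/
noncomputable def cpoch (a : ℂ) (n : ℕ) : ℂ := ∏ i ∈ Finset.range n, (a + i)

/-- Appell's hypergeometric series F₁(α; β₁, β₂; γ; x, y) as a complex double series. -/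
noncomputable def appellF1 (α β₁ β₂ γ x y : ℂ) : ℂ :=
  ∑' p : ℕ × ℕ,
    cpoch α (p.1 + p.2) * cpoch β₁ p.1 * cpoch β₂ p.2 /
      (cpoch γ (p.1 + p.2) * (p.1 ! : ℂ) * (p.2 ! : ℂ)) * x ^ p.1 * y ^ p.2

open PowerSeries Filter Topology

lemma cpoch_succ (a : ℂ) (n : ℕ) : cpoch a (n+1) = cpoch a n * (a + n) := by
  simp [cpoch, Finset.prod_range_succ]

lemma cpoch_zero (a : ℂ) : cpoch a 0 = 1 := by simp [cpoch]

lemma cpoch_succ' (a : ℂ) (n : ℕ) : cpoch a (n+1) = a * cpoch (a+1) n := by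
  unfold cpoch
  rw [Finset.prod_range_succ']
  simp only [Nat.cast_zero, add_zero, mul_comm]
  congr 1
  apply Finset.prod_congr rfl
  intro i _
  push_cast; ring

lemma cpoch_ne (a : ℂ) (h : ∀ n : ℕ, a ≠ -(n:ℂ)) (n : ℕ) : cpoch a n ≠ 0 := by
  unfold cpoch
  rw [Finset.prod_ne_zero_iff]
  intro i _ h0
  exact h i (eq_neg_of_add_eq_zero_left h0)

noncomputable def bs (β x : ℂ) : PowerSeries ℂ := PowerSeries.mk fun n => cpoch β n / (n ! : ℂ) * x ^ n

lemma bs_mul (β x : ℂ) : (1 - C x * X) * bs (β+1) x = bs β x := by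
  ext n
  rw [sub_mul, one_mul, map_sub, mul_assoc, coeff_C_mul]
  cases n with
  | zero => simp [bs, cpoch_zero]
  | succ n =>
    rw [coeff_succ_X_mul]
    simp only [bs, coeff_mk]
    rw [cpoch_succ, cpoch_succ', Nat.factorial_succ]
    have h1 : ((n ! : ℕ) : ℂ) ≠ 0 := by exact_mod_cast Nat.factorial_ne_zero n
    have h2 : ((n : ℂ) + 1) ≠ 0 := by exact_mod_cast Nat.succ_ne_zero n
    push_cast
    field_simp
    ring

lemma bs_deriv (β x : ℂ) : derivative ℂ (bs β x) = C (β * x) * bs (β+1) x := by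
  ext n
  rw [coeff_derivative, coeff_C_mul]
  simp only [bs, coeff_mk]
  rw [cpoch_succ', Nat.factorial_succ]
  have h1 : ((n ! : ℕ) : ℂ) ≠ 0 := by exact_mod_cast Nat.factorial_ne_zero n
  have h2 : ((n : ℂ) + 1) ≠ 0 := by exact_mod_cast Nat.succ_ne_zero n
  push_cast
  field_simp
  ring

lemma bs_ode (β x : ℂ) : (1 - C x * X) * derivative ℂ (bs β x) = C (β * x) * bs β x := by
  rw [bs_deriv, ← bs_mul β x]; ring

/-- geometric bound from the limit ratio -/
lemma geom_bound (s : ℕ → ℂ) (r : ℕ → ℂ) (l : ℂ) (ρ : ℝ) (hρ : ‖l‖ < ρ)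
    (hs : ∀ n, s (n+1) = r n * s n) (hr : Tendsto r atTop (𝓝 l)) :
    ∃ K : ℝ, 0 ≤ K ∧ ∀ n, ‖s n‖ ≤ K * ρ ^ n := by
  have hρ0 : 0 < ρ := lt_of_le_of_lt (norm_nonneg _) hρ
  have h1 : ∀ᶠ n in atTop, ‖r n‖ < ρ := hr.norm.eventually_lt_const hρ
  obtain ⟨N, hN⟩ := eventually_atTop.1 h1
  refine ⟨∑ i ∈ Finset.range (N+1), ‖s i‖ / ρ ^ i, by positivity, ?_⟩
  have key : ∀ n ≤ N, ‖s n‖ ≤ (∑ i ∈ Finset.range (N+1), ‖s i‖ / ρ ^ i) * ρ ^ n := by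
    intro n hn
    rw [← div_le_iff₀ (by positivity)]
    exact Finset.single_le_sum (f := fun i => ‖s i‖ / ρ ^ i) (fun i _ => by positivity)
      (Finset.mem_range.2 (by omega))
  intro n
  induction n with
  | zero => exact key 0 (Nat.zero_le _)
  | succ n ih =>
    by_cases hn : n + 1 ≤ N
    · exact key _ hn
    · rw [hs, norm_mul, pow_succ]
      have := hN n (by omega)
      calc ‖r n‖ * ‖s n‖ ≤ ρ * ((∑ i ∈ Finset.range (N+1), ‖s i‖ / ρ ^ i) * ρ ^ n) := by
            gcongr
        _ = _ := by ring

lemma ratio_tendsto (a b : ℂ) : Tendsto (fun n : ℕ => (a + n) / (b + n)) atTop (𝓝 1) := by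
  have h := tendsto_add_mul_div_add_mul_atTop_nhds a b (1:ℂ) (d := 1) one_ne_zero
  simpa using h

lemma w_bound (a b : ℂ) : ∃ K : ℝ, 0 ≤ K ∧ ∀ n, ‖cpoch a n / cpoch b n‖ ≤ K * 2 ^ n := by
  apply geom_bound _ (fun n : ℕ => (a + n) / (b + n)) 1 2 (by norm_num) _ (ratio_tendsto a b)
  intro n
  rw [cpoch_succ, cpoch_succ, mul_div_mul_comm, mul_comm]

lemma b_bound (β x : ℂ) (hx : ‖x‖ < 1/4) :
    ∃ K : ℝ, 0 ≤ K ∧ ∀ n, ‖coeff n (bs β x)‖ ≤ K * (1/4) ^ n := by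
  apply geom_bound _ (fun n : ℕ => (β + n) / (1 + n) * x) (1 * x) (1/4) (by simpa using hx) _
    ((ratio_tendsto β 1).mul_const x)
  intro n
  simp only [bs, coeff_mk]
  rw [cpoch_succ, Nat.factorial_succ]
  have h1 : ((n ! : ℕ) : ℂ) ≠ 0 := by exact_mod_cast Nat.factorial_ne_zero n
  have h2 : (1 + (n : ℂ)) ≠ 0 := by rw [add_comm]; exact_mod_cast Nat.succ_ne_zero n
  have h3 : ((n : ℂ) + 1) ≠ 0 := by exact_mod_cast Nat.succ_ne_zero n
  push_cast
  rw [add_comm (1:ℂ) (n:ℂ)]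
  field_simp
  ring

lemma g_bound (β₁ β₂ x y : ℂ) (hx : ‖x‖ < 1/4) (hy : ‖y‖ < 1/4) :
    ∃ K : ℝ, 0 ≤ K ∧ ∀ n, ‖coeff n (bs β₁ x * bs β₂ y)‖ ≤ K * ((n + 1) * (1/4) ^ n) := by
  obtain ⟨K₁, h1, hK1⟩ := b_bound β₁ x hx
  obtain ⟨K₂, h2, hK2⟩ := b_bound β₂ y hy
  refine ⟨K₁ * K₂, by positivity, fun n => ?_⟩
  rw [coeff_mul]
  refine (norm_sum_le _ _).trans ?_
  have : ∀ p ∈ Finset.HasAntidiagonal.antidiagonal n, ‖coeff p.1 (bs β₁ x) * coeff p.2 (bs β₂ y)‖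
      ≤ K₁ * K₂ * (1/4) ^ n := by
    intro p hp
    rw [← Finset.HasAntidiagonal.mem_antidiagonal.1 hp, norm_mul, pow_add]
    calc _ ≤ (K₁ * (1/4) ^ p.1) * (K₂ * (1/4) ^ p.2) := by
          gcongr
          · exact hK1 _
          · exact hK2 _
      _ = _ := by ring
  refine (Finset.sum_le_card_nsmul _ _ _ this).trans (le_of_eq ?_)
  simp
  ring

lemma F1_hasSum (α β₁ β₂ γ x y : ℂ) (hx : ‖x‖ < 1/4) (hy : ‖y‖ < 1/4) :
    HasSum (fun k => cpoch α k / cpoch γ k * coeff k (bs β₁ x * bs β₂ y))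
      (appellF1 α β₁ β₂ γ x y) := by
  obtain ⟨K₁, h1, hK1⟩ := b_bound β₁ x hx
  obtain ⟨K₂, h2, hK2⟩ := b_bound β₂ y hy
  obtain ⟨K₃, h3, hK3⟩ := w_bound α γ
  set f : ℕ × ℕ → ℂ := fun p => cpoch α (p.1+p.2) / cpoch γ (p.1+p.2) *
    (coeff p.1 (bs β₁ x) * coeff p.2 (bs β₂ y)) with hf
  have hsum : Summable f := by
    have hg : Summable (fun n : ℕ => ((1:ℝ)/2) ^ n) := summable_geometric_two
    have hg2 := (hg.mul_of_nonneg hg (fun _ => by positivity) (fun _ => by positivity)).mul_left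
      (K₃ * K₁ * K₂)
    refine Summable.of_norm_bounded hg2 ?_
    intro p
    simp only [hf, norm_mul]
    calc _ ≤ (K₃ * 2 ^ (p.1+p.2)) * ((K₁ * (1/4) ^ p.1) * (K₂ * (1/4) ^ p.2)) := by
          gcongr
          · exact hK3 _
          · exact hK1 _
          · exact hK2 _
      _ = K₃ * K₁ * K₂ * ((2 * (1/4)) ^ p.1 * (2 * (1/4)) ^ p.2) := by
          rw [pow_add, mul_pow, mul_pow]; ring
      _ = _ := by norm_num
  have heq : appellF1 α β₁ β₂ γ x y = ∑' p, f p := by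
    unfold appellF1
    apply tsum_congr
    intro p
    simp only [hf, bs, coeff_mk, div_eq_mul_inv, mul_inv]
    ring
  rw [heq]
  have h := (Finset.HasAntidiagonal.sigmaAntidiagonalEquivProd (A := ℕ)).hasSum_iff.2 hsum.hasSum
  have h' := h.sigma (fun k => hasSum_fintype _)
  convert h' using 1
  funext k
  rw [coeff_mul, Finset.mul_sum, ← Finset.sum_coe_sort (Finset.HasAntidiagonal.antidiagonal k)]
  apply Finset.sum_congr rfl
  rintro ⟨p, hp⟩ _
  simp only [hf, Function.comp]
  have := Finset.HasAntidiagonal.mem_antidiagonal.1 hp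
  simp [this]

lemma ps_identity (a : ℂ) (G : PowerSeries ℂ)
    (hG : (1 - C (1/81:ℂ) * X) * (1 - C (1/6:ℂ) * X) * derivative ℂ G =
      (C ((a+3/2) * (1/81)) * (1 - C (1/6:ℂ) * X) + C ((4*a+3) * (1/6)) * (1 - C (1/81:ℂ) * X)) * G)
    (h : PowerSeries ℂ)
    (hh : h = (C (-6561:ℂ) + C (-1053:ℂ) * X + C (81/4:ℂ) * X^2) *
      ((1 - C (1/81:ℂ) * X) * (1 - C (1/6:ℂ) * X)) * G) :
    C (5^5 * (2*a+1)) * (X^2 * G) -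
      C (3^8 * (2*a)) * ((1 - C (1/81:ℂ) * X) * (1 - C (1/6:ℂ) * X)^4 * G) =
    C (2*a) * h + X * derivative ℂ h - X * (C (2*a+1/2) * h + X * derivative ℂ h) := by
  obtain ⟨Z, hZ⟩ : ∃ Z : PowerSeries ℂ, Z = C (1/486:ℂ) * X := ⟨_, rfl⟩
  have hC : ∀ r s : ℂ, C r * (C s * (X : PowerSeries ℂ)) = C (r * s) * X := by
    intro r s; rw [map_mul, mul_assoc]
  have hX : (X : PowerSeries ℂ) = 486 * Z := by
    rw [hZ, show (486 : PowerSeries ℂ) = C (486:ℂ) from (map_ofNat C 486).symm, hC]; norm_num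
  have e1 : C (1/81:ℂ) * (X : PowerSeries ℂ) = 6 * Z := by
    rw [hZ, show (6 : PowerSeries ℂ) = C (6:ℂ) from (map_ofNat C 6).symm, hC]; norm_num
  have e2 : C (1/6:ℂ) * (X : PowerSeries ℂ) = 81 * Z := by
    rw [hZ, show (81 : PowerSeries ℂ) = C (81:ℂ) from (map_ofNat C 81).symm, hC]; norm_num
  have e3 : C (81/4:ℂ) * (X : PowerSeries ℂ) ^ 2 = 4782969 * Z ^ 2 := by
    rw [hZ, show (4782969 : PowerSeries ℂ) = C (4782969:ℂ) from (map_ofNat C 4782969).symm, mul_pow, ← mul_assoc,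
      ← map_pow, ← map_mul]; norm_num
  have e4 : X * C ((a+3/2) * (1/81)) = (2 * C a + 3) * 3 * Z := by
    rw [hZ, show (2 * C a + 3) * 3 * (C (1/486:ℂ) * X) = C ((2 * a + 3) * 3 * (1/486)) * X by
      simp only [map_mul, map_add, map_ofNat]; ring, mul_comm]
    congr 2; ring
  have e5 : X * C ((4*a+3) * (1/6)) = (4 * C a + 3) * 81 * Z := by
    rw [hZ, show (4 * C a + 3) * 81 * (C (1/486:ℂ) * X) = C ((4 * a + 3) * 81 * (1/486)) * X by
      simp only [map_mul, map_add, map_ofNat]; ring, mul_comm]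
    congr 2; ring
  have e6 : X * C (2*a+1/2) = (972 * C a + 243) * Z := by
    rw [hZ, show (972 * C a + 243) * (C (1/486:ℂ) * X) = C ((972 * a + 243) * (1/486)) * X by
      simp only [map_mul, map_add, map_ofNat]; ring, mul_comm]
    congr 2; ring
  have e7 : C (-6561:ℂ) = (-6561 : PowerSeries ℂ) := by rw [map_neg, map_ofNat]
  have e8 : C (-1053:ℂ) = (-1053 : PowerSeries ℂ) := by rw [map_neg, map_ofNat]
  have e9 : C (5^5 * (2*a+1)) = (3125 * (2 * C a + 1) : PowerSeries ℂ) := by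
    simp only [map_mul, map_add, map_ofNat, map_pow, map_one]; norm_num
  have e10 : C (3^8 * (2*a)) = (6561 * (2 * C a) : PowerSeries ℂ) := by
    simp only [map_mul, map_add, map_ofNat, map_pow, map_one]; norm_num
  have e11 : C (2*a) = (2 * C a : PowerSeries ℂ) := by
    simp only [map_mul, map_ofNat]
  have dZ : X * derivative ℂ Z = Z := by
    have : derivative ℂ Z = C (1/486:ℂ) := by
      rw [hZ, Derivation.leibniz]; simp
    rw [this, hZ, mul_comm]
  have hG' : (1 - 6 * Z) * (1 - 81 * Z) * (X * derivative ℂ G) =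
      ((2 * C a + 3) * 3 * Z * (1 - 81 * Z) + (4 * C a + 3) * 81 * Z * (1 - 6 * Z)) * G := by
    rw [e1, e2] at hG
    linear_combination X * hG + ((1 - 81 * Z) * e4 + (1 - 6 * Z) * e5) * G
  rw [e1, e2, e3, e7, e8, hX] at hh
  have hh2 : h = (-6561 - 1053 * 486 * Z + 4782969 * Z ^ 2) * ((1 - 6 * Z) * (1 - 81 * Z)) * G := by
    rw [hh]; ring
  have hd : X * derivative ℂ h =
      ((- 1053 * 486 * Z + 2 * 4782969 * Z ^ 2) * ((1 - 6 * Z) * (1 - 81 * Z))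
       + (-6561 - 1053 * 486 * Z + 4782969 * Z ^ 2) * (-6 * Z * (1 - 81 * Z) - 81 * Z * (1 - 6 * Z)))
        * G
      + (-6561 - 1053 * 486 * Z + 4782969 * Z ^ 2) *
       (((2 * C a + 3) * 3 * Z * (1 - 81 * Z) + (4 * C a + 3) * 81 * Z * (1 - 6 * Z)) * G) := by
    have q : ∀ n : ℕ, n = 6 ∨ True → derivative ℂ ((n : PowerSeries ℂ)) = 0 := by
      intro n _; exact Derivation.map_natCast _ n
    have q1 : derivative ℂ (6 : PowerSeries ℂ) = 0 := by exact_mod_cast q 6 (Or.inr trivial)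
    have q2 : derivative ℂ (81 : PowerSeries ℂ) = 0 := by exact_mod_cast q 81 (Or.inr trivial)
    have q3 : derivative ℂ (6561 : PowerSeries ℂ) = 0 := by exact_mod_cast q 6561 (Or.inr trivial)
    have q4 : derivative ℂ (1053 : PowerSeries ℂ) = 0 := by exact_mod_cast q 1053 (Or.inr trivial)
    have q5 : derivative ℂ (486 : PowerSeries ℂ) = 0 := by exact_mod_cast q 486 (Or.inr trivial)
    have q6 : derivative ℂ (4782969 : PowerSeries ℂ) = 0 := by
      exact_mod_cast q 4782969 (Or.inr trivial)
    rw [← hG', hh2]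
    simp only [Derivation.leibniz, map_add, map_sub, map_neg, pow_two, q1, q2, q3, q4, q5, q6,
      smul_eq_mul, Derivation.map_one_eq_zero]
    linear_combination (((- 1053 * 486 + 2 * 4782969 * Z) * ((1 - 6 * Z) * (1 - 81 * Z))
       + (-6561 - 1053 * 486 * Z + 4782969 * Z ^ 2) * (-6 * (1 - 81 * Z) - 81 * (1 - 6 * Z)))
        * G) * dZ
  rw [mul_add X, ← mul_assoc X (C (2*a+1/2)), e1, e2, e6, e9, e10, e11, hd, hh2, hX]
  ring

lemma coeff_aux (c : ℂ) (h : PowerSeries ℂ) (γ : ℂ) (k : ℕ) :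
    coeff (k+1) (C c * h + X * derivative ℂ h - X * (C γ * h + X * derivative ℂ h)) =
    (c + (k + 1)) * coeff (k+1) h - (γ + k) * coeff k h := by
  rw [map_sub, map_add, coeff_C_mul, coeff_succ_X_mul, coeff_succ_X_mul, map_add, coeff_C_mul,
    coeff_derivative]
  cases k with
  | zero => simp; ring
  | succ k =>
    rw [coeff_succ_X_mul, coeff_derivative]; push_cast; ring


lemma final_aux (a : ℂ) (hpole : ∀ n : ℕ, 2*a + 1/2 ≠ -(n : ℂ)) (G A h : PowerSeries ℂ)
    (h0 : -3^8 * coeff 0 A = coeff 0 h)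
    (hid : C (5^5 * (2*a+1)) * (X^2 * G) - C (3^8 * (2*a)) * A =
      C (2*a) * h + X * derivative ℂ h - X * (C (2*a+1/2) * h + X * derivative ℂ h)) (N : ℕ) :
    (2*a+1)^2 * 5^5 * (∑ k ∈ Finset.range N, cpoch (2*(a+1)) k / cpoch (2*(a+1)+1/2) k * coeff k G)
     - (2*a+1/2)*(2*a+3/2) * 3^8 *
      (∑ k ∈ Finset.range (N+2), cpoch (2*a) k / cpoch (2*a+1/2) k * coeff k A) =
    (2*a+1/2)*(2*a+3/2) * (cpoch (2*a+1) (N+1) / cpoch (2*a+1/2) (N+1) * coeff (N+1) h) := by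
  have hc := cpoch_ne _ hpole
  have hg : ∀ n : ℕ, 2*a+1/2+n ≠ 0 := fun n h => hpole n (eq_neg_of_add_eq_zero_left h)
  induction N with
  | zero =>
    have h1 := congrArg (coeff 1) hid
    rw [coeff_aux _ _ _ 0] at h1
    have hz : coeff 1 (X^2 * G) = 0 := by
      rw [pow_two, mul_assoc, coeff_succ_X_mul]; simp
    rw [map_sub, coeff_C_mul, coeff_C_mul, hz] at h1
    have hg0 := hg 0
    simp only [Finset.sum_range_succ, Finset.sum_range_zero, cpoch_succ, cpoch_zero]
    simp only [Nat.cast_zero, add_zero, zero_add, one_mul, Nat.cast_one] at *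
    rw [← h0] at h1
    have hi := mul_inv_cancel₀ hg0
    simp only [div_eq_mul_inv, one_mul, inv_one, mul_one] at *
    generalize (2 * a + 2⁻¹)⁻¹ = i at *
    linear_combination (2*a+2⁻¹)*(2*a+3*2⁻¹) * i * h1 +
      (2*a+2⁻¹)*(2*a+3*2⁻¹) * 3^8 * coeff 0 A * hi
  | succ N ih =>
    have h1 := congrArg (coeff (N+2)) hid
    rw [coeff_aux _ _ _ (N+1)] at h1
    have hz : coeff (N+2) (X^2 * G) = coeff N G := by
      rw [pow_two, mul_assoc, coeff_succ_X_mul, coeff_succ_X_mul]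
    rw [map_sub, coeff_C_mul, coeff_C_mul, hz] at h1
    rw [Finset.sum_range_succ, Finset.sum_range_succ _ (N+2)]
    have k1 : (2*a+1) * cpoch (2*(a+1)) N = cpoch (2*a+1) (N+1) := by
      rw [cpoch_succ']; congr 2; ring
    have k2 : (2*a+1/2)*(2*a+3/2) * cpoch (2*(a+1)+1/2) N = cpoch (2*a+1/2) (N+2) := by
      rw [cpoch_succ', cpoch_succ', mul_assoc]; congr 2
      · ring
      · congr 1; ring
    have k3 : cpoch (2*a) (N+2) = 2 * a * cpoch (2*a+1) (N+1) := cpoch_succ' _ _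
    have k4 := cpoch_succ (2*a+1) (N+1)
    have k5 := cpoch_succ (2*a+1/2) (N+1)
    have c1 := hc (N+1)
    have c2 := hc (N+2)
    have c3 := hg (N+1)
    have g0 : (2*a+1/2)*(2*a+3/2) ≠ 0 := by
      refine mul_ne_zero (by simpa using hg 0) ?_
      have := hg 1
      intro h; apply this; push_cast; linear_combination h
    have k6 : cpoch (2*(a+1)+1/2) N ≠ 0 := by
      intro h; rw [h, mul_zero] at k2; exact c2 k2.symm
    have k7 : (2*a+1) * (cpoch (2*(a+1)) N / cpoch (2*(a+1)+1/2) N)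
        = (2*a+1/2)*(2*a+3/2) * (cpoch (2*a+1) (N+1) / cpoch (2*a+1/2) (N+2)) := by
      rw [← k1, ← k2]
      rw [mul_div_mul_comm, ← mul_assoc, ← mul_div_assoc, mul_div_cancel₀ _ g0, mul_div_assoc]
    have k8 : cpoch (2*a+1) (N+1) / cpoch (2*a+1/2) (N+1) =
        (2*a+1/2 + ((N+1 : ℕ):ℂ)) * (cpoch (2*a+1) (N+1) / cpoch (2*a+1/2) (N+2)) := by
      rw [show N + 2 = N + 1 + 1 from rfl, k5, ← mul_div_assoc, mul_comm (cpoch (2*a+1/2) (N+1)),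
        mul_div_mul_left _ _ c3]
    rw [k3, mul_div_assoc (2*a)]
    rw [show N + 1 + 1 = N + 2 from rfl, k4, mul_comm (cpoch (2*a+1) (N+1)), mul_div_assoc]
    rw [k8] at ih
    generalize cpoch (2*a+1) (N+1) / cpoch (2*a+1/2) (N+2) = U at *
    push_cast at *
    linear_combination ih + (2*a+1) * 5^5 * coeff N G * k7 + (2*a+1/2)*(2*a+3/2) * U * h1

def Dec (f : PowerSeries ℂ) : Prop :=
  ∃ K : ℝ, 0 ≤ K ∧ ∀ n, ‖coeff n f‖ ≤ K * ((n + 1) * (1/4) ^ n)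

lemma Dec.add {f g : PowerSeries ℂ} (hf : Dec f) (hg : Dec g) : Dec (f + g) := by
  obtain ⟨K, hK, h1⟩ := hf
  obtain ⟨L, hL, h2⟩ := hg
  refine ⟨K + L, by positivity, fun n => ?_⟩
  rw [map_add, add_mul]
  exact (norm_add_le _ _).trans (add_le_add (h1 n) (h2 n))

lemma Dec.smul {f : PowerSeries ℂ} (c : ℂ) (hf : Dec f) : Dec (C c * f) := by
  obtain ⟨K, hK, h1⟩ := hf
  refine ⟨‖c‖ * K, by positivity, fun n => ?_⟩
  rw [coeff_C_mul, norm_mul, mul_assoc]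
  gcongr
  exact h1 n

lemma Dec.X_mul {f : PowerSeries ℂ} (hf : Dec f) : Dec (X * f) := by
  obtain ⟨K, hK, h1⟩ := hf
  refine ⟨4 * K, by positivity, fun n => ?_⟩
  cases n with
  | zero => simp; positivity
  | succ n =>
    rw [coeff_succ_X_mul]
    refine (h1 n).trans ?_
    rw [pow_succ]
    push_cast
    have : 0 ≤ K * (1/4)^n := by positivity
    nlinarith

lemma Dec.tendsto {f : PowerSeries ℂ} (hf : Dec f) (α γ : ℂ) :
    Tendsto (fun n => cpoch α n / cpoch γ n * coeff n f) atTop (𝓝 0) := by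
  obtain ⟨K, hK, h1⟩ := hf
  obtain ⟨L, hL, h2⟩ := w_bound α γ
  have t1 := tendsto_self_mul_const_pow_of_lt_one (r := (1/2:ℝ)) (by norm_num) (by norm_num)
  have t2 := tendsto_pow_atTop_nhds_zero_of_lt_one (r := (1/2:ℝ)) (by norm_num) (by norm_num)
  have t3 := (t1.add t2).const_mul (L * K)
  rw [add_zero, mul_zero] at t3
  refine squeeze_zero_norm (fun n => ?_) t3
  rw [norm_mul]
  calc _ ≤ (L * 2 ^ n) * (K * ((n + 1) * (1/4) ^ n)) := by
        gcongr
        · exact h2 n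
        · exact h1 n
    _ = L * K * ((n + 1) * (2 * (1/4)) ^ n) := by rw [mul_pow]; ring
    _ = _ := by norm_num; left; ring

theorem stmt19 (a : ℂ) (hpole : ∀ n : ℕ, 2*a + 1/2 ≠ -(n : ℂ)) :
    appellF1 (2*(a+1)) ((a+1) + 1/2) (4*(a+1) - 1) (2*(a+1) + 1/2) (1/81) (1/6) *
        (a + 1/2) ^ 2 * 2 ^ 2 * 5 ^ 5 =
      appellF1 (2*a) (a + 1/2) (4*a - 1) (2*a + 1/2) (1/81) (1/6) *
        3 ^ 8 * ((2*a + 1/2) * (2*a + 3/2)) := by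
  have hx : ‖(1/81 : ℂ)‖ < 1/4 := by norm_num
  have hy : ‖(1/6 : ℂ)‖ < 1/4 := by norm_num
  have s1 := F1_hasSum (2*(a+1)) ((a+1) + 1/2) (4*(a+1) - 1) (2*(a+1) + 1/2) (1/81) (1/6) hx hy
  have s2 := F1_hasSum (2*a) (a + 1/2) (4*a - 1) (2*a + 1/2) (1/81) (1/6) hx hy
  set F' := appellF1 (2*(a+1)) ((a+1) + 1/2) (4*(a+1) - 1) (2*(a+1) + 1/2) (1/81) (1/6)
  set F := appellF1 (2*a) (a + 1/2) (4*a - 1) (2*a + 1/2) (1/81) (1/6)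
  have m1 : (1 - C (1/81:ℂ) * X) * bs ((a+1) + 1/2) (1/81) = bs (a+1/2) (1/81) := by
    rw [← bs_mul (a+1/2)]; congr 2; ring
  have m2 : (1 - C (1/6:ℂ) * X) * bs (4*(a+1)-1) (1/6) = bs (4*a+2) (1/6) := by
    rw [← bs_mul (4*a+2)]; congr 2; ring
  have m3 : (1 - C (1/6:ℂ) * X) * bs (4*a+2) (1/6) = bs (4*a+1) (1/6) := by
    rw [← bs_mul (4*a+1)]; congr 2; ring
  have m4 : (1 - C (1/6:ℂ) * X) * bs (4*a+1) (1/6) = bs (4*a) (1/6) := by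
    rw [← bs_mul (4*a)]
  have m5 : (1 - C (1/6:ℂ) * X) * bs (4*a) (1/6) = bs (4*a-1) (1/6) := by
    rw [← bs_mul (4*a-1)]; congr 2; ring
  have o1 := bs_ode ((a+1)+1/2) (1/81)
  have o2 := bs_ode (4*(a+1)-1) (1/6)
  rw [show (a+1)+1/2 = a+3/2 by ring] at o1 m1 s1
  rw [show 4*(a+1)-1 = 4*a+3 by ring] at o2 m2 s1
  set b1 := bs (a+3/2) (1/81)
  set b2 := bs (4*a+3) (1/6)
  have hG : (1 - C (1/81:ℂ) * X) * (1 - C (1/6:ℂ) * X) * derivative ℂ (b1 * b2) =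
      (C ((a+3/2) * (1/81)) * (1 - C (1/6:ℂ) * X) + C ((4*a+3) * (1/6)) * (1 - C (1/81:ℂ) * X))
        * (b1 * b2) := by
    rw [Derivation.leibniz, smul_eq_mul, smul_eq_mul]
    linear_combination (1 - C (1/6:ℂ) * X) * b2 * o1 + (1 - C (1/81:ℂ) * X) * b1 * o2
  have hA : (1 - C (1/81:ℂ) * X) * (1 - C (1/6:ℂ) * X)^4 * (b1 * b2) =
      bs (a+1/2) (1/81) * bs (4*a-1) (1/6) := by
    rw [← m5, ← m4, ← m3, ← m2, ← m1]; ring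
  have hid := ps_identity a (b1 * b2) hG _ rfl
  rw [hA] at hid
  have hdec : Dec ((C (-6561:ℂ) + C (-1053:ℂ) * X + C (81/4:ℂ) * X^2) *
      ((1 - C (1/81:ℂ) * X) * (1 - C (1/6:ℂ) * X)) * (b1 * b2)) := by
    have hd : Dec (bs (a+1/2) (1/81) * bs (4*a+2) (1/6)) := g_bound _ _ _ _ hx hy
    have := ((hd.smul (-6561)).add (hd.X_mul.smul (-1053))).add (hd.X_mul.X_mul.smul (81/4))
    convert this using 1
    rw [← m1, ← m2]; ring
  set h := (C (-6561:ℂ) + C (-1053:ℂ) * X + C (81/4:ℂ) * X^2) *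
      ((1 - C (1/81:ℂ) * X) * (1 - C (1/6:ℂ) * X)) * (b1 * b2) with hh
  have h0 : -3^8 * coeff 0 (bs (a+1/2) (1/81) * bs (4*a-1) (1/6)) = coeff 0 h := by
    rw [← hA, hh]
    simp
    norm_num
  have hfin := final_aux a hpole _ _ h h0 hid
  have t1 := (s1.tendsto_sum_nat.const_mul ((2*a+1)^2 * 5^5)).sub
    ((s2.tendsto_sum_nat.comp (tendsto_add_atTop_nat 2)).const_mul
      ((2*a+1/2)*(2*a+3/2) * 3^8))
  have t2 := ((hdec.tendsto (2*a+1) (2*a+1/2)).comp (tendsto_add_atTop_nat 1)).const_mul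
    ((2*a+1/2)*(2*a+3/2))
  have := tendsto_nhds_unique (t1.congr hfin) t2
  linear_combination this
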